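/- Let ℜ = (S,(𝒦,𝒢),(X,ℬ),(ℱ,𝒯)) be a Riesz system, Z a uniform commutative monoid, and ℓ : ℱ → Z a Riesz integral over ℜ. Then for each B∈ℬ, W∈unif Z and disjoint sequence α in 𝒦, there exists m∈ℕ such that α_n is W-small with respect to (τ_ℓ, B) for all n > m. -/

import Mathlib

open Filter Set Topology
open scoped Pointwise

universe u v w

/-- A member of `unif M`: a closed, translation-invariant, symmetric entourage of the
uniform commutative monoid `M`. -/
def IsUnifEnt (M : Type*) [AddCommMonoid M] [UniformSpace M] (W : Set (M × M)) : Prop :=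
  W ∈ uniformity M ∧ IsClosed W ∧
    (∀ p ∈ W, ∀ t : M, (p.1 + t, p.2 + t) ∈ W) ∧ ∀ p ∈ W, (p.2, p.1) ∈ W

/-- `f` is supported by `α` (written `f ≺ α`): `f` vanishes off some `κ ∈ 𝒦` with `κ ⊆ α`. -/
def SupportedBy {S : Type u} {X : Type v} [Zero X]
    (𝒦 : Set (Set S)) (f : S → X) (α : Set S) : Prop :=
  ∃ κ ∈ 𝒦, κ ⊆ α ∧ ∀ s ∉ κ, f s = 0

/-- `f` equals `x` over `α`: `f` is identically `x` on some `γ ∈ 𝒢` containing `α`. -/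
def EqualsOver {S : Type u} {X : Type v}
    (𝒢 : Set (Set S)) (f : S → X) (x : X) (α : Set S) : Prop :=
  ∃ γ ∈ 𝒢, α ⊆ γ ∧ ∀ s ∈ γ, f s = x

/-- `ℱ_B`: members of `ℱ` with range contained in `B`. -/
def FB {S : Type u} {X : Type v} (ℱ : Set (S → X)) (B : Set X) : Set (S → X) :=
  {f | f ∈ ℱ ∧ Set.range f ⊆ B}

/-- the `ℬ`-hull of `x`: intersection of all members of `ℬ` containing `x`. -/
def BHull {X : Type v} (ℬ : Set (Set X)) (x : X) : Set X :=
  ⋂₀ {B | B ∈ ℬ ∧ x ∈ B}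

/-- the `ℬ`-hull of a subset `A` of `X`. -/
def BHullS {X : Type v} (ℬ : Set (Set X)) (A : Set X) : Set X :=
  ⋂₀ {B | B ∈ ℬ ∧ A ⊆ B}

/-- A field of subsets of `S`. -/
def IsSetField {S : Type u} (ℰ : Set (Set S)) : Prop :=
  Set.univ ∈ ℰ ∧ (∀ A ∈ ℰ, Aᶜ ∈ ℰ) ∧ ∀ A ∈ ℰ, ∀ B ∈ ℰ, A ∪ B ∈ ℰ

/-- `ℰ`: the smallest field of subsets of `S` containing `𝒦 ∪ 𝒢`. -/
def genField {S : Type u} (𝒦 𝒢 : Set (Set S)) : Set (Set S) :=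
  ⋂₀ {ℰ | 𝒦 ∪ 𝒢 ⊆ ℰ ∧ IsSetField ℰ}

/-- A Riesz system `(S,(𝒦,𝒢),(X,ℬ),(ℱ,𝒯))` (Assumptions 2.3 of the paper). -/
structure RieszSystem {S : Type u} {X : Type v} [AddCommMonoid X] [UniformSpace X]
    (𝒦 𝒢 : Set (Set S)) (ℬ : Set (Set X)) (ℱ : Set (S → X))
    (𝒯 : Filter ((S → X) × (S → X))) : Prop where
  K_empty : ∅ ∈ 𝒦
  K_union : ∀ κ₁ ∈ 𝒦, ∀ κ₂ ∈ 𝒦, κ₁ ∪ κ₂ ∈ 𝒦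
  G_empty : ∅ ∈ 𝒢
  G_union : ∀ γ₁ ∈ 𝒢, ∀ γ₂ ∈ 𝒢, γ₁ ∪ γ₂ ∈ 𝒢
  G_inter : ∀ γ₁ ∈ 𝒢, ∀ γ₂ ∈ 𝒢, γ₁ ∩ γ₂ ∈ 𝒢
  KG_diff : ∀ κ ∈ 𝒦, ∀ γ ∈ 𝒢, κ \ γ ∈ 𝒦 ∧ γ \ κ ∈ 𝒢
  KG_interpose : ∀ κ ∈ 𝒦, ∀ γ ∈ 𝒢, κ ⊆ γ →
      ∃ γ' ∈ 𝒢, ∃ κ' ∈ 𝒦, κ ⊆ γ' ∧ γ' ⊆ κ' ∧ κ' ⊆ γ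
  X_add : UniformContinuous fun p : X × X => p.1 + p.2
  B_nonempty : ℬ.Nonempty
  B_inter : ∀ 𝒞 ⊆ ℬ, 𝒞.Nonempty → ⋂₀ 𝒞 ∈ ℬ
  B_zero : ∀ B ∈ ℬ, (0 : X) ∈ B
  B_add : ∀ B ∈ ℬ, ∀ B' ∈ ℬ, ∃ C ∈ ℬ, B + B' ⊆ C
  B_cover : ∀ x : X, ∃ B ∈ ℬ, x ∈ B
  F_zero : (0 : S → X) ∈ ℱ
  F_add : ∀ f ∈ ℱ, ∀ g ∈ ℱ, f + g ∈ ℱ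
  T_refl : ∀ T ∈ 𝒯, ∀ f ∈ ℱ, (f, f) ∈ T
  T_symm : ∀ T ∈ 𝒯, ∃ V ∈ 𝒯, ∀ f g : S → X, (f, g) ∈ V → (g, f) ∈ T
  T_comp : ∀ T ∈ 𝒯, ∃ V ∈ 𝒯, ∀ f g h : S → X, (f, g) ∈ V → (g, h) ∈ V → (f, h) ∈ T
  T_add : ∀ T ∈ 𝒯, ∃ V ∈ 𝒯, ∀ f f' g g' : S → X,
      (f, f') ∈ V → (g, g') ∈ V → (f + g, f' + g') ∈ T
  F_range : ∀ f ∈ ℱ, ∃ B ∈ ℬ, Set.range f ⊆ B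
  F_partble : ∀ f ∈ ℱ, ∀ W ∈ uniformity X, ∃ G : Finset (Set S), ↑G ⊆ 𝒢 ∧
      (⋃ γ ∈ G, γ) = Set.univ ∧ ∀ γ ∈ G, ∀ s ∈ γ, ∀ t ∈ γ, (f s, f t) ∈ W
  F_urysohn : ∀ κ ∈ 𝒦, ∀ γ ∈ 𝒢, κ ⊆ γ → ∀ x : X, ∃ f ∈ ℱ,
      Set.range f ⊆ BHull ℬ x ∧ SupportedBy 𝒦 f γ ∧ EqualsOver 𝒢 f x κ
  F_ext : ∀ B ∈ ℬ, ∀ T ∈ 𝒯, ∃ U ∈ uniformity X, ∀ κ ∈ 𝒦, ∀ γ ∈ 𝒢, κ ⊆ γ →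
      ∀ f ∈ FB ℱ B, ∀ g ∈ FB ℱ B, SupportedBy 𝒦 f γ → SupportedBy 𝒦 g γ →
      (∃ ω ∈ 𝒢, κ ⊆ ω ∧ ω ⊆ γ ∧ ∀ s ∈ ω, (f s, g s) ∈ U) →
      ∃ p ∈ FB ℱ B, ∃ q ∈ FB ℱ B, SupportedBy 𝒦 p (γ \ κ) ∧
        SupportedBy 𝒦 q (γ \ κ) ∧ (f + p, g + q) ∈ T
  F_partunity : ∀ B ∈ ℬ, ∀ G : Finset (Set S), ↑G ⊆ 𝒢 → ∀ κ ∈ 𝒦, κ ⊆ (⋃ γ ∈ G, γ) →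
      ∀ f ∈ FB ℱ B, ∃ g : Set S → (S → X),
        (∀ γ ∈ G, g γ ∈ FB ℱ B ∧ SupportedBy 𝒦 (g γ) γ) ∧
        (∀ J : Finset (Set S), J ⊆ G → (∑ γ ∈ J, g γ) ∈ FB ℱ B) ∧
        ∀ s ∈ κ, f s = ∑ γ ∈ G, g γ s

/-- `f` and `g` are `ℰ`-separated. -/
def ESeparated {S : Type u} {X : Type v} [Zero X]
    (𝒦 𝒢 : Set (Set S)) (f g : S → X) : Prop :=
  ∃ E₁ ∈ genField 𝒦 𝒢, ∃ E₂ ∈ genField 𝒦 𝒢, Disjoint E₁ E₂ ∧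
    SupportedBy 𝒦 f E₁ ∧ SupportedBy 𝒦 g E₂

/-- `ℓ` is `ℰ`-additive. -/
def EAdditive {S : Type u} {X : Type v} {Z : Type w} [AddCommMonoid X] [AddCommMonoid Z]
    (𝒦 𝒢 : Set (Set S)) (ℱ : Set (S → X)) (ℓ : (S → X) → Z) : Prop :=
  ∀ f ∈ ℱ, ∀ g ∈ ℱ, ESeparated 𝒦 𝒢 f g → ℓ (f + g) = ℓ f + ℓ g

/-- `ℓ` is `s`-bounded over `ℬ`. -/
def SBounded {S : Type u} {X : Type v} {Z : Type w} [AddCommMonoid X]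
    [AddCommMonoid Z] [UniformSpace Z]
    (𝒦 𝒢 : Set (Set S)) (ℬ : Set (Set X)) (ℱ : Set (S → X)) (ℓ : (S → X) → Z) : Prop :=
  ∀ B ∈ ℬ, ∀ W : Set (Z × Z), IsUnifEnt Z W → ∀ G : ℕ → Set S, (∀ n, G n ∈ 𝒢) →
    (∀ m n : ℕ, m ≠ n → Disjoint (G m) (G n)) → ∃ m : ℕ, ∀ n > m,
      ∀ f ∈ FB ℱ B, ∀ g ∈ FB ℱ B, SupportedBy 𝒦 g (G n) → (ℓ f, ℓ (f + g)) ∈ W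

/-- `ℓ` is uniformly continuous on `A` with respect to the uniformity `𝒯`. -/
def UContOn {S : Type u} {X : Type v} {Z : Type w} [UniformSpace Z]
    (𝒯 : Filter ((S → X) × (S → X))) (A : Set (S → X)) (ℓ : (S → X) → Z) : Prop :=
  ∀ W ∈ uniformity Z, ∃ T ∈ 𝒯, ∀ f ∈ A, ∀ g ∈ A, (f, g) ∈ T → (ℓ f, ℓ g) ∈ W

/-- A relatively complete subset of a uniform space. -/
def RelComplete {Z : Type w} [UniformSpace Z] (A : Set Z) : Prop :=
  IsComplete (closure A)

/-- `ℓ` is a Riesz integral over the Riesz system `(S,(𝒦,𝒢),(X,ℬ),(ℱ,𝒯))`. -/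
def RieszIntegral {S : Type u} {X : Type v} {Z : Type w} [AddCommMonoid X]
    [AddCommMonoid Z] [UniformSpace Z]
    (𝒦 𝒢 : Set (Set S)) (ℬ : Set (Set X)) (ℱ : Set (S → X))
    (𝒯 : Filter ((S → X) × (S → X))) (ℓ : (S → X) → Z) : Prop :=
  EAdditive 𝒦 𝒢 ℱ ℓ ∧ SBounded 𝒦 𝒢 ℬ ℱ ℓ ∧
    ∀ B ∈ ℬ, UContOn 𝒯 (FB ℱ B) ℓ ∧ RelComplete (ℓ '' FB ℱ B)

/-- The members of a finite family of sets are pairwise disjoint. -/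
def PairwiseDisjFinset {S : Type u} (K : Finset (Set S)) : Prop :=
  ∀ κ₁ ∈ K, ∀ κ₂ ∈ K, κ₁ ≠ κ₂ → Disjoint κ₁ κ₂

/-- `α` is `W`-small with respect to `(h, B)`. -/
def WSmall {S : Type u} {X : Type v} {Z : Type w} [AddCommMonoid X] [AddCommMonoid Z]
    (𝒦 𝒢 : Set (Set S)) (h : Set S → X → Z) (B : Set X)
    (W : Set (Z × Z)) (α : Set S) : Prop :=
  ∃ γ ∈ 𝒢, α ⊆ γ ∧ ∀ K : Finset (Set S), ↑K ⊆ 𝒦 → PairwiseDisjFinset K →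
    (∀ κ ∈ K, κ ⊆ γ) → ∀ x y : Set S → X, (∀ κ ∈ K, x κ ∈ B) → (∀ κ ∈ K, y κ ∈ B) →
      (∑ κ ∈ K, h κ (x κ), ∑ κ ∈ K, h κ (x κ + y κ)) ∈ W

/-- `α` is regular with respect to `(h, 𝒦, 𝒢, ℬ)`. -/
def RegularSet {S : Type u} {X : Type v} {Z : Type w} [AddCommMonoid X]
    [AddCommMonoid Z] [UniformSpace Z]
    (𝒦 𝒢 : Set (Set S)) (ℬ : Set (Set X)) (h : Set S → X → Z) (α : Set S) : Prop :=
  ∀ B ∈ ℬ, ∀ V : Set (Z × Z), IsUnifEnt Z V →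
    ∃ κ ∈ 𝒦, ∃ γ ∈ 𝒢, κ ⊆ α ∧ α ⊆ γ ∧ WSmall 𝒦 𝒢 h B V (γ \ κ)

/-- `R_h`: the family of regular sets of `h`. -/
def RSet {S : Type u} {X : Type v} {Z : Type w} [AddCommMonoid X]
    [AddCommMonoid Z] [UniformSpace Z]
    (𝒦 𝒢 : Set (Set S)) (ℬ : Set (Set X)) (h : Set S → X → Z) : Set (Set S) :=
  {α | RegularSet 𝒦 𝒢 ℬ h α}

/-- `h` is uniformly partition continuous with respect to `(𝒦,𝒢,ℬ)`. -/
def UPartCont {S : Type u} {X : Type v} {Z : Type w} [AddCommMonoid X] [UniformSpace X]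
    [AddCommMonoid Z] [UniformSpace Z]
    (𝒦 𝒢 : Set (Set S)) (ℬ : Set (Set X)) (h : Set S → X → Z) : Prop :=
  ∀ W : Set (Z × Z), IsUnifEnt Z W → ∀ B ∈ ℬ, ∃ U ∈ uniformity X,
    ∀ R : Finset (Set S), ↑R ⊆ RSet 𝒦 𝒢 ℬ h → PairwiseDisjFinset R →
    ∀ x y : Set S → X, (∀ ρ ∈ R, x ρ ∈ B ∧ y ρ ∈ B ∧ (x ρ, y ρ) ∈ U) →
      (∑ ρ ∈ R, h ρ (x ρ), ∑ ρ ∈ R, h ρ (y ρ)) ∈ W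

/-- `h` is `s`-bounded with respect to `(𝒦,𝒢,ℬ)`. -/
def MSBounded {S : Type u} {X : Type v} {Z : Type w} [AddCommMonoid X]
    [AddCommMonoid Z] [UniformSpace Z]
    (𝒦 𝒢 : Set (Set S)) (ℬ : Set (Set X)) (h : Set S → X → Z) : Prop :=
  ∀ B ∈ ℬ, ∀ α : ℕ → Set S, (∀ n, α n ∈ RSet 𝒦 𝒢 ℬ h) →
    (∀ m n : ℕ, m ≠ n → Disjoint (α m) (α n)) → ∀ V : Set (Z × Z), IsUnifEnt Z V →
      ∃ m : ℕ, ∀ n > m, WSmall 𝒦 𝒢 h B V (α n)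

/-- `𝒱(h,𝒦,𝒢,B)`: all finite sums `∑_{ρ∈R} x_ρ.h(ρ)`. -/
def VSums {S : Type u} {X : Type v} {Z : Type w} [AddCommMonoid X]
    [AddCommMonoid Z] [UniformSpace Z]
    (𝒦 𝒢 : Set (Set S)) (ℬ : Set (Set X)) (h : Set S → X → Z) (B : Set X) : Set Z :=
  {z | ∃ R : Finset (Set S), ↑R ⊆ RSet 𝒦 𝒢 ℬ h ∧ PairwiseDisjFinset R ∧
    ∃ x : Set S → X, (∀ ρ ∈ R, x ρ ∈ B) ∧ z = ∑ ρ ∈ R, h ρ (x ρ)}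

/-- `z` is the limit of the net `(F κ x : κ ∈ 𝒦, κ ⊆ γ)` directed by inclusion. -/
def KBelowLim {S : Type u} {X : Type v} {Z : Type w} [TopologicalSpace Z]
    (𝒦 : Set (Set S)) (γ : Set S) (F : Set S → X → Z) (x : X) (z : Z) : Prop :=
  Tendsto (fun κ : {κ : Set S // κ ∈ 𝒦 ∧ κ ⊆ γ} => F κ.1 x) atTop (nhds z)

/-- `z` is the limit of the net `(F γ' x : γ' ∈ 𝒢, α ⊆ γ')` directed by reverse inclusion. -/
def GAboveLim {S : Type u} {X : Type v} {Z : Type w} [TopologicalSpace Z]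
    (𝒢 : Set (Set S)) (α : Set S) (F : Set S → X → Z) (x : X) (z : Z) : Prop :=
  Tendsto (fun γ : {γ : Set S // γ ∈ 𝒢 ∧ α ⊆ γ} => F γ.1 x) atBot (nhds z)

/-- `h` is a Riesz measure over `(𝒦,𝒢,ℬ)`. -/
def RieszMeasure {S : Type u} {X : Type v} {Z : Type w} [AddCommMonoid X] [UniformSpace X]
    [AddCommMonoid Z] [UniformSpace Z]
    (𝒦 𝒢 : Set (Set S)) (ℬ : Set (Set X)) (h : Set S → X → Z) : Prop :=
  𝒢 ⊆ RSet 𝒦 𝒢 ℬ h ∧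
  IsSetField (RSet 𝒦 𝒢 ℬ h) ∧
  (∀ ρ₁ ∈ RSet 𝒦 𝒢 ℬ h, ∀ ρ₂ ∈ RSet 𝒦 𝒢 ℬ h, Disjoint ρ₁ ρ₂ →
      ∀ x : X, h (ρ₁ ∪ ρ₂) x = h ρ₁ x + h ρ₂ x) ∧
  (∀ γ ∈ 𝒢, ∀ x : X, KBelowLim 𝒦 γ h x (h γ x)) ∧
  (∀ α : Set S, ∀ x : X, GAboveLim 𝒢 α h x (h α x)) ∧
  UPartCont 𝒦 𝒢 ℬ h ∧ MSBounded 𝒦 𝒢 ℬ h ∧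
  ∀ B ∈ ℬ, RelComplete (VSums 𝒦 𝒢 ℬ h B)

/-- The finite disjoint family `R` refines `Q`. -/
def RefinesF {S : Type u} (R Q : Finset (Set S)) : Prop :=
  ∀ ρ ∈ R, ∃ q ∈ Q, ρ ⊆ q

/-- `R` is a finite disjoint partition of `E` by sets regular for `h`. -/
def IsPartitionOf {S : Type u} {X : Type v} {Z : Type w} [AddCommMonoid X]
    [AddCommMonoid Z] [UniformSpace Z]
    (𝒦 𝒢 : Set (Set S)) (ℬ : Set (Set X)) (h : Set S → X → Z)
    (R : Finset (Set S)) (E : Set S) : Prop :=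
  ↑R ⊆ RSet 𝒦 𝒢 ℬ h ∧ PairwiseDisjFinset R ∧ (⋃ ρ ∈ R, ρ) = E

/-- `z = ∫_E f.dμ`. -/
def IsIntegralOf {S : Type u} {X : Type v} {Z : Type w} [AddCommMonoid X]
    [AddCommMonoid Z] [UniformSpace Z]
    (𝒦 𝒢 : Set (Set S)) (ℬ : Set (Set X)) (μ : Set S → X → Z)
    (E : Set S) (f : S → X) (z : Z) : Prop :=
  ∀ V ∈ nhds z, ∃ Q : Finset (Set S), IsPartitionOf 𝒦 𝒢 ℬ μ Q E ∧
    ∀ R : Finset (Set S), IsPartitionOf 𝒦 𝒢 ℬ μ R E → RefinesF R Q →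
      ∀ s : Set S → S, (∀ ρ ∈ R, s ρ ∈ ρ) → (∑ ρ ∈ R, μ ρ (f (s ρ))) ∈ V

/-- `ℱ*(x,κ,γ,B)`. -/
def FStar {S : Type u} {X : Type v} [Zero X]
    (𝒦 𝒢 : Set (Set S)) (ℱ : Set (S → X)) (x : X) (κ γ : Set S) (B : Set X) :
    Set (S → X) :=
  {f | f ∈ FB ℱ B ∧ EqualsOver 𝒢 f x κ ∧ SupportedBy 𝒦 f γ}

/-- `τ` is the set function `τ_ℓ` generated by `ℓ` on `𝒦`. -/
def IsTau {S : Type u} {X : Type v} {Z : Type w} [AddCommMonoid X] [UniformSpace Z]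
    (𝒦 𝒢 : Set (Set S)) (ℬ : Set (Set X)) (ℱ : Set (S → X))
    (ℓ : (S → X) → Z) (τ : Set S → X → Z) : Prop :=
  ∀ κ ∈ 𝒦, ∀ x : X, ∀ V ∈ nhds (τ κ x), ∃ β ∈ 𝒢, κ ⊆ β ∧
    ℓ '' FStar 𝒦 𝒢 ℱ x κ β (BHull ℬ x) ⊆ V

/-- `ξ = ξ_ℓ` is the pointwise limit of `τ = τ_ℓ` over `𝒦⁻(γ)`. -/
def IsXi {S : Type u} {X : Type v} {Z : Type w} [TopologicalSpace Z]
    (𝒦 𝒢 : Set (Set S)) (τ ξ : Set S → X → Z) : Prop :=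
  ∀ γ ∈ 𝒢, ∀ x : X, KBelowLim 𝒦 γ τ x (ξ γ x)

/-- `ν = ν_ℓ` is the pointwise limit of `ξ = ξ_ℓ` over `𝒢⁺(α)`. -/
def IsNu {S : Type u} {X : Type v} {Z : Type w} [TopologicalSpace Z]
    (𝒢 : Set (Set S)) (ξ ν : Set S → X → Z) : Prop :=
  ∀ α : Set S, ∀ x : X, GAboveLim 𝒢 α ξ x (ν α x)

/-- `S(W,B,ℓ)`. -/
def SWB {S : Type u} {X : Type v} {Z : Type w} [AddCommMonoid X]
    (𝒦 𝒢 : Set (Set S)) (ℱ : Set (S → X)) (ℓ : (S → X) → Z)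
    (W : Set (Z × Z)) (B : Set X) : Set (Set S) :=
  {γ | γ ∈ 𝒢 ∧ ∀ f ∈ FB ℱ B, ∀ g ∈ FB ℱ B, SupportedBy 𝒦 g γ → (ℓ f, ℓ (f + g)) ∈ W}

/-- `ℓ` has the Hammerstein property relative to `ℰ`. -/
def Hammerstein {S : Type u} {X : Type v} {Z : Type w} [AddCommMonoid X] [AddCommMonoid Z]
    (𝒦 𝒢 : Set (Set S)) (ℱ : Set (S → X)) (ℓ : (S → X) → Z) : Prop :=
  ∀ f ∈ ℱ, ∀ g₁ ∈ ℱ, ∀ g₂ ∈ ℱ, ESeparated 𝒦 𝒢 g₁ g₂ →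
    ℓ (f + g₁ + g₂) + ℓ f = ℓ (f + g₁) + ℓ (f + g₂)

/-- `ℓ` is quasi-additive. -/
def QuasiAdditive {S : Type u} {X : Type v} {Z : Type w} [AddCommMonoid X]
    [AddCommMonoid Z] [UniformSpace Z]
    (ℬ : Set (Set X)) (ℱ : Set (S → X)) (ℓ : (S → X) → Z) : Prop :=
  ∀ W : Set (Z × Z), IsUnifEnt Z W → ∀ B ∈ ℬ, ∃ V : Set (Z × Z), IsUnifEnt Z V ∧
    ∀ f ∈ FB ℱ B, ∀ g ∈ FB ℱ B, ((0 : Z), ℓ g) ∈ V → (ℓ f, ℓ (f + g)) ∈ W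

/-- A perfect subset of `Z`: any function whose finite partial sums all lie in the set
is summable. -/
def PerfectSet {Z : Type w} [AddCommMonoid Z] [TopologicalSpace Z] (A : Set Z) : Prop :=
  ∀ ⦃ι : Type w⦄ (g : ι → Z), (∀ J : Finset ι, ∑ i ∈ J, g i ∈ A) → Summable g

/-- A quasi-perfect subset of `Z`: any function whose finite partial sums all lie in the
set has a Cauchy net of finite partial sums. -/
def QuasiPerfectSet {Z : Type w} [AddCommMonoid Z] [UniformSpace Z] (A : Set Z) : Prop :=
  ∀ ⦃ι : Type w⦄ (g : ι → Z), (∀ J : Finset ι, ∑ i ∈ J, g i ∈ A) →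
    Cauchy (Filter.map (fun J : Finset ι => ∑ i ∈ J, g i) Filter.atTop)

/-- `α` is `U`-small with respect to `(ℓ, B)`. -/
def USmallOp {S : Type u}{X : Type v} {Z : Type w} [AddCommMonoid X] [Zero X]
    (𝒦 : Set (Set S)) (ℱ : Set (S → X)) (ℓ : (S → X) → Z) (B : Set X)
    (U : Set (Z × Z)) (α : Set S) : Prop :=
  ∀ f ∈ FB ℱ B, ∀ g ∈ FB ℱ B, SupportedBy 𝒦 g α → (ℓ f, ℓ (f + g)) ∈ U

/-- `ℓ` is `𝒢`-bounded. -/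
def GBounded {S : Type u} {X : Type v} {Z : Type w} [AddCommMonoid X]
    [AddCommMonoid Z] [UniformSpace Z]
    (𝒦 𝒢 : Set (Set S)) (ℬ : Set (Set X)) (ℱ : Set (S → X)) (ℓ : (S → X) → Z) : Prop :=
  ∀ U : Set (Z × Z), IsUnifEnt Z U → ∀ B ∈ ℬ, ∀ K ∈ 𝒦, ∀ 𝒢' ⊆ 𝒢, K ⊆ ⋃₀ 𝒢' →
    ∃ H : Finset (Set S), ↑H ⊆ 𝒢' ∧ USmallOp 𝒦 ℱ ℓ B U (K \ ⋃ γ ∈ H, γ)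

/-- `ℬ₀` (Notation 2.2). -/
def B0 {X : Type v} [AddCommMonoid X] (ℬ : Set (Set X)) : Set (Set X) :=
  ⋂₀ {ℋ | ℋ ⊆ ℬ ∧ (∀ 𝒞 ⊆ ℋ, 𝒞.Nonempty → ⋂₀ 𝒞 ∈ ℋ) ∧ ⋂₀ ℋ = {0} ∧
      (∀ x : X, BHull ℬ x ∈ ℋ) ∧ ∀ H₁ ∈ ℋ, ∀ H₂ ∈ ℋ, BHullS ℬ (H₁ + H₂) ∈ ℋ}

/-- `ℱ₀` (Notation 2.2). -/
def F0 {S : Type u} {X : Type v} [AddCommMonoid X]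
    (ℬ : Set (Set X)) (ℱ : Set (S → X)) : Set (S → X) :=
  {f | f ∈ ℱ ∧ ∃ B ∈ B0 ℬ, Set.range f ⊆ B}

/-- The uniformity of uniform convergence on `S`, as a filter on `(S → X) × (S → X)`. -/
def UnifConvFilter (S : Type u) (X : Type v) [UniformSpace X] :
    Filter ((S → X) × (S → X)) :=
  ⨅ V ∈ uniformity X, Filter.principal {p : (S → X) × (S → X) | ∀ s : S, (p.1 s, p.2 s) ∈ V}

/-- The additional conditions of Remark 2.5.1 on a Riesz system. -/
structure Remark251 {S : Type u} {X : Type v} [TopologicalSpace S]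
    [AddCommGroup X] [Module ℝ X] [UniformSpace X]
    (𝒦 𝒢 : Set (Set S)) (ℬ : Set (Set X)) (ℱ : Set (S → X))
    (𝒯 : Filter ((S → X) × (S → X))) : Prop where
  K_closed : ∀ κ ∈ 𝒦, IsClosed κ
  G_open : ∀ γ ∈ 𝒢, IsOpen γ
  B_def : ℬ = {B : Set X | IsClosed B ∧ TotallyBounded B}
  F_sub : ∀ f ∈ ℱ, Continuous f ∧ TotallyBounded (Set.range f)
  F_module : ∀ φ : S → ℝ, Continuous φ → TotallyBounded (Set.range φ) →
      ∀ f ∈ ℱ, (fun s => φ s • f s) ∈ ℱ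
  F_tensor : ∀ x : X, ∀ φ : S → ℝ, Continuous φ → TotallyBounded (Set.range φ) →
      (∃ κ ∈ 𝒦, ∀ s ∉ κ, φ s = 0) → (fun s => φ s • x) ∈ ℱ
  T_coarser : UnifConvFilter S X ≤ 𝒯

/-- `A` is a bounded subset of the "topological vector space" `(ℱ,𝒯)`:
it is absorbed by every `𝒯`-neighbourhood of `0`. -/
def FBddIn {S : Type u} {X : Type v} [AddCommGroup X] [Module ℝ X]
    (𝒯 : Filter ((S → X) × (S → X))) (A : Set (S → X)) : Prop :=
  ∀ T ∈ 𝒯, ∃ r : ℝ, 0 < r ∧ ∀ f ∈ A, ∀ c : ℝ, |c| ≤ r → ((0 : S → X), c • f) ∈ T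

section Entourages

variable {Z : Type w} [AddCommMonoid Z] [UniformSpace Z]

theorem exists_isUnifEnt_subset (hZadd : UniformContinuous fun p : Z × Z => p.1 + p.2)
    {U : Set (Z × Z)} (hU : U ∈ uniformity Z) : ∃ V ⊆ U, IsUnifEnt Z V := by
  obtain ⟨U', ⟨hU', hU'c⟩, hU'U⟩ := uniformity_hasBasis_closed.mem_iff.1 hU
  have hswap : Prod.swap ⁻¹' U' ∈ uniformity Z := tendsto_swap_uniformity hU'
  have hc : ∀ t : Z, Continuous fun z : Z => z + t := fun t =>
    hZadd.continuous.comp (by fun_prop : Continuous fun z : Z => (z, t))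
  have hset : {p : Z × Z | ∀ t : Z, (p.1 + t, p.2 + t) ∈ U' ∧ (p.2 + t, p.1 + t) ∈ U'} =
      ⋂ t : Z, ((fun p : Z × Z => (p.1 + t, p.2 + t)) ⁻¹' U' ∩
        (fun p : Z × Z => (p.2 + t, p.1 + t)) ⁻¹' U') := by
    ext p; simp
  refine ⟨{p | ∀ t : Z, (p.1 + t, p.2 + t) ∈ U' ∧ (p.2 + t, p.1 + t) ∈ U'}, ?_, ?_, ?_, ?_, ?_⟩
  · intro p hp
    have h := (hp 0).1
    simp only [add_zero] at h
    exact hU'U h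
  · obtain ⟨V, hV, h⟩ := mem_uniformity_of_uniformContinuous_invariant
      (f := fun a b : Z => a + b) hZadd (inter_mem hU' hswap)
    exact mem_of_superset hV fun p hp t => h p.1 p.2 t hp
  · rw [hset]
    exact isClosed_iInter fun t =>
      (hU'c.preimage (((hc t).comp continuous_fst).prodMk ((hc t).comp continuous_snd))).inter
        (hU'c.preimage (((hc t).comp continuous_snd).prodMk ((hc t).comp continuous_fst)))
  · intro p hp t s
    simpa only [add_assoc] using hp (t + s)
  · intro p hp t
    exact (hp t).symm

/-- A sequence of members of `unif M` each of which contains the composite of its successor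
with itself. -/
structure IsCompSeq (M : Type*) [AddCommMonoid M] [UniformSpace M]
    (V : ℕ → Set (M × M)) : Prop where
  ent : ∀ n, IsUnifEnt M (V n)
  comp : ∀ n a b c, (a, b) ∈ V (n + 1) → (b, c) ∈ V (n + 1) → (a, c) ∈ V n

theorem exists_isCompSeq (hZadd : UniformContinuous fun p : Z × Z => p.1 + p.2)
    {U : Set (Z × Z)} (hU : U ∈ uniformity Z) : ∃ V, IsCompSeq Z V ∧ V 0 ⊆ U := by
  have step : ∀ A : {A : Set (Z × Z) // IsUnifEnt Z A}, ∃ A' : {A : Set (Z × Z) // IsUnifEnt Z A},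
      ∀ a b c, (a, b) ∈ A'.1 → (b, c) ∈ A'.1 → (a, c) ∈ A.1 := by
    intro A
    obtain ⟨t, ht, htA⟩ := comp_mem_uniformity_sets A.2.1
    obtain ⟨V, hVt, hV⟩ := exists_isUnifEnt_subset hZadd ht
    exact ⟨⟨V, hV⟩, fun a b c hab hbc => htA ⟨b, hVt hab, hVt hbc⟩⟩
  choose next hnext using step
  obtain ⟨V₀, hV₀U, hV₀⟩ := exists_isUnifEnt_subset hZadd hU
  let V : ℕ → {A : Set (Z × Z) // IsUnifEnt Z A} := fun n => Nat.rec ⟨V₀, hV₀⟩ (fun _ A => next A) n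
  exact ⟨fun n => (V n).1, ⟨fun n => (V n).2, fun n => hnext (V n)⟩, hV₀U⟩

namespace IsCompSeq

variable {V : ℕ → Set (Z × Z)} (hV : IsCompSeq Z V)
include hV

theorem refl (n : ℕ) (a : Z) : (a, a) ∈ V n :=
  refl_mem_uniformity (hV.ent n).1

theorem symm (n : ℕ) {a b : Z} (h : (a, b) ∈ V n) : (b, a) ∈ V n :=
  (hV.ent n).2.2.2 _ h

theorem succ (n : ℕ) {a b : Z} (h : (a, b) ∈ V (n + 1)) : (a, b) ∈ V n :=
  hV.comp n a b b h (hV.refl _ b)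

theorem shift (k : ℕ) : IsCompSeq Z fun n => V (n + k) where
  ent n := hV.ent (n + k)
  comp n := by
    have h := hV.comp (n + k)
    rwa [Nat.add_right_comm] at h

theorem chain (a : ℕ → Z) (k i : ℕ)
    (h : ∀ j, i ≤ j → j < i + k → (a j, a (j + 1)) ∈ V (j + 1)) : (a i, a (i + k)) ∈ V i := by
  induction k generalizing i with
  | zero => exact hV.refl i _
  | succ k ih =>
    have h₁ := ih (i + 1) fun j hj hj' => h j (by omega) (by omega)
    rw [show i + 1 + k = i + (k + 1) by omega] at h₁
    exact hV.comp i _ _ _ (h i le_rfl (by omega)) h₁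

end IsCompSeq

theorem exists_entourage_sum (hZadd : UniformContinuous fun p : Z × Z => p.1 + p.2)
    {ι : Type*} (K : Finset ι) {U : Set (Z × Z)} (hU : U ∈ uniformity Z) :
    ∃ E ∈ uniformity Z, ∀ t z : ι → Z, (∀ i ∈ K, (t i, z i) ∈ E) →
      (∑ i ∈ K, t i, ∑ i ∈ K, z i) ∈ U := by
  classical
  induction K using Finset.induction_on generalizing U with
  | empty =>
    refine ⟨univ, univ_mem, fun t z _ => ?_⟩
    simpa using refl_mem_uniformity hU
  | insert a K ha ih =>
    have h := hZadd hU
    rw [mem_map, uniformity_prod_eq_prod, mem_map, mem_prod_iff] at h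
    obtain ⟨P, hP, Q, hQ, hPQ⟩ := h
    obtain ⟨E, hE, hEQ⟩ := ih hQ
    refine ⟨P ∩ E, inter_mem hP hE, fun t z htz => ?_⟩
    rw [Finset.sum_insert ha, Finset.sum_insert ha]
    have h₁ := (htz a (Finset.mem_insert_self a K)).1
    have h₂ := hEQ t z fun i hi => (htz i (Finset.mem_insert_of_mem hi)).2
    exact @hPQ ((t a, z a), (∑ i ∈ K, t i, ∑ i ∈ K, z i)) ⟨h₁, h₂⟩

end Entourages

section Supports

variable {S : Type u} {X : Type v} {𝒦 𝒢 : Set (Set S)}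

theorem SupportedBy.mono [Zero X] {f : S → X} {α β : Set S} (h : SupportedBy 𝒦 f α)
    (hαβ : α ⊆ β) : SupportedBy 𝒦 f β :=
  let ⟨κ, hκ, hκα, hf⟩ := h
  ⟨κ, hκ, hκα.trans hαβ, hf⟩

theorem SupportedBy.eq_zero [Zero X] {f : S → X} {α : Set S} (h : SupportedBy 𝒦 f α)
    {s : S} (hs : s ∉ α) : f s = 0 :=
  let ⟨_, _, hκα, hf⟩ := h
  hf s fun hsκ => hs (hκα hsκ)

theorem isSetField_genField (𝒦 𝒢 : Set (Set S)) : IsSetField (genField 𝒦 𝒢) :=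
  ⟨fun _ h => h.2.1, fun A hA _ h => h.2.2.1 A (hA _ h),
    fun A hA B hB _ h => h.2.2.2 A (hA _ h) B (hB _ h)⟩

theorem subset_genField (𝒦 𝒢 : Set (Set S)) : 𝒢 ⊆ genField 𝒦 𝒢 :=
  fun _ hA _ h => h.1 (Or.inr hA)

theorem sum_apply_of_disjoint_support [AddCommMonoid X] {K : Finset (Set S)}
    {b : Set S → Set S} (hb : ∀ κ ∈ K, ∀ κ' ∈ K, κ ≠ κ' → Disjoint (b κ) (b κ'))
    {f : Set S → S → X} (hf : ∀ κ ∈ K, SupportedBy 𝒦 (f κ) (b κ))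
    {κ : Set S} (hκ : κ ∈ K) {s : S} (hs : s ∈ b κ) : (∑ κ ∈ K, f κ) s = f κ s := by
  rw [Finset.sum_apply]
  refine Finset.sum_eq_single_of_mem κ hκ fun κ' hκ' hne => (hf κ' hκ').eq_zero fun hs' => ?_
  exact (hb κ' hκ' κ hκ hne).le_bot ⟨hs', hs⟩

theorem FB.mono {ℱ : Set (S → X)} {B C : Set X} (h : B ⊆ C) : FB ℱ B ⊆ FB ℱ C :=
  fun _ hf => ⟨hf.1, hf.2.trans h⟩

end Supports

section Systems

variable {S : Type u} {X : Type v} [AddCommMonoid X]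
  {𝒦 𝒢 : Set (Set S)} {ℬ : Set (Set X)} {ℱ : Set (S → X)}

theorem SWB.mono {Z : Type w} {ℓ : (S → X) → Z} {W : Set (Z × Z)} {B : Set X} {γ γ' : Set S}
    (h : γ ∈ SWB 𝒦 𝒢 ℱ ℓ W B) (hγ' : γ' ∈ 𝒢) (hγ : γ' ⊆ γ) : γ' ∈ SWB 𝒦 𝒢 ℱ ℓ W B :=
  ⟨hγ', fun f hf g hg hs => h.2 f hf g hg (hs.mono hγ)⟩

namespace RieszSystem

variable [UniformSpace X] {𝒯 : Filter ((S → X) × (S → X))} (hR : RieszSystem 𝒦 𝒢 ℬ ℱ 𝒯)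
include hR

theorem G_biUnion {ι : Type*} (J : Finset ι) {A : ι → Set S} (h : ∀ i ∈ J, A i ∈ 𝒢) :
    (⋃ i ∈ J, A i) ∈ 𝒢 := by
  classical
  induction J using Finset.induction_on with
  | empty => simpa using hR.G_empty
  | insert a J _ ih =>
    rw [Finset.set_biUnion_insert]
    exact hR.G_union _ (h a (Finset.mem_insert_self a J)) _
      (ih fun i hi => h i (Finset.mem_insert_of_mem hi))

theorem K_biUnion {ι : Type*} (J : Finset ι) {A : ι → Set S} (h : ∀ i ∈ J, A i ∈ 𝒦) :
    (⋃ i ∈ J, A i) ∈ 𝒦 := by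
  classical
  induction J using Finset.induction_on with
  | empty => simpa using hR.K_empty
  | insert a J _ ih =>
    rw [Finset.set_biUnion_insert]
    exact hR.K_union _ (h a (Finset.mem_insert_self a J)) _
      (ih fun i hi => h i (Finset.mem_insert_of_mem hi))

theorem univ_mem_G : univ ∈ 𝒢 := by
  obtain ⟨G, hG, hU, -⟩ := hR.F_partble 0 hR.F_zero univ univ_mem
  rw [← hU]
  exact hR.G_biUnion G fun γ hγ => hG hγ

theorem FB_add {B B' C : Set X} (h : B + B' ⊆ C) {f g : S → X} (hf : f ∈ FB ℱ B)
    (hg : g ∈ FB ℱ B') : f + g ∈ FB ℱ C := by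
  refine ⟨hR.F_add f hf.1 g hg.1, ?_⟩
  rintro _ ⟨s, rfl⟩
  exact h (add_mem_add (hf.2 ⟨s, rfl⟩) (hg.2 ⟨s, rfl⟩))

theorem subset_of_add_subset {B B' C : Set X} (hB' : B' ∈ ℬ) (h : B + B' ⊆ C) : B ⊆ C :=
  fun x hx => h ⟨x, hx, 0, hR.B_zero B' hB', add_zero x⟩

theorem supportedBy_sum {ι : Type*} (J : Finset ι) {f : ι → S → X} {A : ι → Set S}
    (h : ∀ i ∈ J, SupportedBy 𝒦 (f i) (A i)) :
    SupportedBy 𝒦 (∑ i ∈ J, f i) (⋃ i ∈ J, A i) := by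
  choose! κ hκ hκA hf using h
  refine ⟨⋃ i ∈ J, κ i, hR.K_biUnion J hκ, iUnion₂_mono hκA, fun s hs => ?_⟩
  rw [Finset.sum_apply]
  refine Finset.sum_eq_zero fun i hi => hf i hi s fun hsi => hs ?_
  exact mem_iUnion₂_of_mem hi hsi

theorem supportedBy_add {f g : S → X} {α : Set S} (hf : SupportedBy 𝒦 f α)
    (hg : SupportedBy 𝒦 g α) : SupportedBy 𝒦 (f + g) α := by
  obtain ⟨κ, hκ, hκα, hf⟩ := hf
  obtain ⟨κ', hκ', hκα', hg⟩ := hg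
  refine ⟨κ ∪ κ', hR.K_union κ hκ κ' hκ', union_subset hκα hκα', fun s hs => ?_⟩
  rw [mem_union, not_or] at hs
  rw [Pi.add_apply, hf s hs.1, hg s hs.2, add_zero]

theorem FB_sum_of_disjoint_support {B : Set X} (hB : B ∈ ℬ) {K : Finset (Set S)}
    {b : Set S → Set S} (hb : ∀ κ ∈ K, ∀ κ' ∈ K, κ ≠ κ' → Disjoint (b κ) (b κ'))
    {f : Set S → S → X} (hf : ∀ κ ∈ K, SupportedBy 𝒦 (f κ) (b κ))
    (hfB : ∀ κ ∈ K, f κ ∈ FB ℱ B) : ∑ κ ∈ K, f κ ∈ FB ℱ B := by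
  constructor
  · exact Finset.sum_induction f (· ∈ ℱ) (fun f g hf hg => hR.F_add f hf g hg) hR.F_zero
      fun κ hκ => (hfB κ hκ).1
  · rintro _ ⟨s, rfl⟩
    by_cases hs : ∃ κ ∈ K, s ∈ b κ
    · obtain ⟨κ, hκ, hs⟩ := hs
      rw [sum_apply_of_disjoint_support hb hf hκ hs]
      exact (hfB κ hκ).2 ⟨s, rfl⟩
    · rw [Finset.sum_apply, Finset.sum_eq_zero]
      · exact hR.B_zero B hB
      · exact fun κ hκ => (hf κ hκ).eq_zero fun h => hs ⟨κ, hκ, h⟩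

theorem exists_disjoint_nhds (K : Finset (Set S)) (hK : ↑K ⊆ 𝒦) (hd : PairwiseDisjFinset K)
    {β : Set S} (hβ : β ∈ 𝒢) (hKβ : ∀ κ ∈ K, κ ⊆ β) :
    ∃ b : Set S → Set S, (∀ κ ∈ K, b κ ∈ 𝒢 ∧ κ ⊆ b κ ∧ b κ ⊆ β) ∧
      ∀ κ ∈ K, ∀ κ' ∈ K, κ ≠ κ' → Disjoint (b κ) (b κ') := by
  classical
  induction K using Finset.induction_on generalizing β with
  | empty => exact ⟨id, by simp, by simp⟩
  | insert a K ha ih =>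
    have ha𝒦 : a ∈ 𝒦 := hK (Finset.mem_insert_self a K)
    have hK𝒦 : ∀ κ ∈ K, κ ∈ 𝒦 := fun κ hκ => hK (Finset.mem_insert_of_mem hκ)
    have hne : ∀ κ ∈ K, κ ≠ a := fun κ hκ h => ha (h ▸ hκ)
    have hdisj : Disjoint a (⋃ κ ∈ K, κ) := by
      rw [disjoint_iUnion₂_right]
      exact fun κ hκ => hd a (Finset.mem_insert_self a K) κ (Finset.mem_insert_of_mem hκ)
        (hne κ hκ).symm
    obtain ⟨γ', hγ', κ', hκ', haγ', hγκ', hκβ⟩ := hR.KG_interpose a ha𝒦 _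
      (hR.KG_diff _ (hR.K_biUnion K hK𝒦) β hβ).2
      (subset_sdiff.2 ⟨hKβ a (Finset.mem_insert_self a K), hdisj⟩)
    have hsub : ∀ κ ∈ K, κ ⊆ β \ κ' := fun κ hκ => by
      refine subset_sdiff.2 ⟨hKβ κ (Finset.mem_insert_of_mem hκ), ?_⟩
      refine (disjoint_of_subset_left hκβ ?_).symm
      exact disjoint_sdiff_left.mono_right (subset_biUnion_of_mem (u := fun κ => κ) hκ)
    obtain ⟨b, hb, hbd⟩ := ih (fun κ hκ => hK𝒦 κ hκ)
      (fun κ hκ κ₂ hκ₂ => hd κ (Finset.mem_insert_of_mem hκ) κ₂ (Finset.mem_insert_of_mem hκ₂))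
      (hR.KG_diff κ' hκ' β hβ).2 hsub
    have hbγ : ∀ κ ∈ K, Disjoint γ' (b κ) := fun κ hκ =>
      disjoint_sdiff_right.mono hγκ' (hb κ hκ).2.2
    refine ⟨Function.update b a γ', ?_, ?_⟩
    · intro κ hκ
      rcases Finset.mem_insert.1 hκ with rfl | hκ
      · rw [Function.update_self]
        exact ⟨hγ', haγ', hγκ'.trans (hκβ.trans sdiff_subset)⟩
      · rw [Function.update_of_ne (hne κ hκ)]
        exact ⟨(hb κ hκ).1, (hb κ hκ).2.1, (hb κ hκ).2.2.trans sdiff_subset⟩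
    · intro κ hκ κ₂ hκ₂ h
      rcases Finset.mem_insert.1 hκ with rfl | h₁ <;> rcases Finset.mem_insert.1 hκ₂ with rfl | h₂
      · exact absurd rfl h
      · rw [Function.update_self, Function.update_of_ne (hne κ₂ h₂)]
        exact hbγ κ₂ h₂
      · rw [Function.update_self, Function.update_of_ne (hne κ h₁)]
        exact (hbγ κ h₁).symm
      · rw [Function.update_of_ne (hne κ h₁), Function.update_of_ne (hne κ₂ h₂)]
        exact hbd κ h₁ κ₂ h₂ h

end RieszSystem

section Integrals

variable [UniformSpace X] {𝒯 : Filter ((S → X) × (S → X))}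
  {Z : Type w} {ℓ : (S → X) → Z}

theorem IsTau.exists_FStar_near [UniformSpace Z] {τ : Set S → X → Z}
    (hR : RieszSystem 𝒦 𝒢 ℬ ℱ 𝒯) (hτ : IsTau 𝒦 𝒢 ℬ ℱ ℓ τ) {E : Set (Z × Z)}
    (hE : E ∈ uniformity Z) {κ β : Set S}
    (hκ : κ ∈ 𝒦) (hβ : β ∈ 𝒢) (hκβ : κ ⊆ β) (x : X) {B : Set X} (hB : B ∈ ℬ) (hx : x ∈ B) :
    ∃ f ∈ FStar 𝒦 𝒢 ℱ x κ β B, (τ κ x, ℓ f) ∈ E := by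
  obtain ⟨β', hβ', hκβ', hsub⟩ := hτ κ hκ x _ (UniformSpace.ball_mem_nhds _ hE)
  obtain ⟨f, hf, hfr, hfs, hfe⟩ := hR.F_urysohn κ hκ _ (hR.G_inter _ hβ _ hβ')
    (subset_inter hκβ hκβ') x
  exact ⟨f, ⟨⟨hf, hfr.trans (sInter_subset_of_mem ⟨hB, hx⟩)⟩, hfe, hfs.mono inter_subset_left⟩,
    hsub ⟨f, ⟨⟨hf, hfr⟩, hfe, hfs.mono inter_subset_right⟩, rfl⟩⟩

theorem EAdditive.map_sum [AddCommMonoid Z] (hR : RieszSystem 𝒦 𝒢 ℬ ℱ 𝒯)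
    (hadd : EAdditive 𝒦 𝒢 ℱ ℓ)
    {K : Finset (Set S)} (hne : K.Nonempty) {b : Set S → Set S} (hbG : ∀ κ ∈ K, b κ ∈ 𝒢)
    (hb : ∀ κ ∈ K, ∀ κ' ∈ K, κ ≠ κ' → Disjoint (b κ) (b κ'))
    {f : Set S → S → X} (hf : ∀ κ ∈ K, SupportedBy 𝒦 (f κ) (b κ))
    (hfF : ∀ κ ∈ K, f κ ∈ ℱ) : ℓ (∑ κ ∈ K, f κ) = ∑ κ ∈ K, ℓ (f κ) := by
  classical
  induction hne using Finset.Nonempty.cons_induction with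
  | singleton a => simp
  | cons a K ha hne ih =>
    have hmem : ∀ κ ∈ K, κ ∈ Finset.cons a K ha := fun κ hκ => Finset.mem_cons_of_mem hκ
    have ha' := Finset.mem_cons_self a K (h := ha)
    rw [Finset.sum_cons, Finset.sum_cons, ← ih (fun κ hκ => hbG κ (hmem κ hκ))
      (fun κ hκ κ' hκ' => hb κ (hmem κ hκ) κ' (hmem κ' hκ')) (fun κ hκ => hf κ (hmem κ hκ))
      (fun κ hκ => hfF κ (hmem κ hκ))]
    refine hadd _ (hfF a ha') _ ?_ ⟨b a, subset_genField _ _ (hbG a ha'), ⋃ κ ∈ K, b κ,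
      subset_genField _ _ (hR.G_biUnion K fun κ hκ => hbG κ (hmem κ hκ)), ?_, hf a ha',
      hR.supportedBy_sum K fun κ hκ => hf κ (hmem κ hκ)⟩
    · exact Finset.sum_induction f (· ∈ ℱ) (fun f g hf hg => hR.F_add f hf g hg) hR.F_zero
        fun κ hκ => hfF κ (hmem κ hκ)
    · rw [disjoint_iUnion₂_right]
      exact fun κ hκ => hb a ha' κ (hmem κ hκ) fun h => ha (h ▸ hκ)

variable [AddCommMonoid Z] [UniformSpace Z]

theorem SBounded.exists_diff_mem_SWB (hR : RieszSystem 𝒦 𝒢 ℬ ℱ 𝒯) (hs : SBounded 𝒦 𝒢 ℬ ℱ ℓ)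
    {B : Set X} (hB : B ∈ ℬ) {V : Set (Z × Z)} (hV : IsUnifEnt Z V) {κ γ : Set S}
    (hκ : κ ∈ 𝒦) (hγ : γ ∈ 𝒢) (hκγ : κ ⊆ γ) :
    ∃ β ∈ 𝒢, κ ⊆ β ∧ β ⊆ γ ∧ β \ κ ∈ SWB 𝒦 𝒢 ℱ ℓ V B := by
  by_contra! hcon
  let N := {β : Set S // β ∈ 𝒢 ∧ κ ⊆ β ∧ β ⊆ γ}
  have step : ∀ β : N, ∃ (β' : N) (δ : Set S), β'.1 ⊆ β.1 ∧ δ ∈ 𝒢 ∧ δ ⊆ β.1 ∧ Disjoint δ β'.1 ∧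
      ∃ f ∈ FB ℱ B, ∃ g ∈ FB ℱ B, SupportedBy 𝒦 g δ ∧ (ℓ f, ℓ (f + g)) ∉ V := by
    rintro ⟨β, hβ, hκβ, hβγ⟩
    have hdiff := (hR.KG_diff κ hκ β hβ).2
    have h : ∃ f ∈ FB ℱ B, ∃ g ∈ FB ℱ B, SupportedBy 𝒦 g (β \ κ) ∧ (ℓ f, ℓ (f + g)) ∉ V := by
      by_contra! h
      exact hcon β hβ hκβ hβγ ⟨hdiff, h⟩
    obtain ⟨f, hf, g, hg, ⟨κ₁, hκ₁, hκ₁β, hg₀⟩, hfg⟩ := h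
    obtain ⟨δ, hδ, κ₂, hκ₂, hκ₁δ, hδκ₂, hκ₂β⟩ := hR.KG_interpose κ₁ hκ₁ _ hdiff hκ₁β
    refine ⟨⟨β \ κ₂, (hR.KG_diff κ₂ hκ₂ β hβ).2, ?_, sdiff_subset.trans hβγ⟩, δ, sdiff_subset, hδ,
      hδκ₂.trans (hκ₂β.trans sdiff_subset), disjoint_sdiff_right.mono_left hδκ₂,
      f, hf, g, hg, ⟨κ₁, hκ₁, hκ₁δ, hg₀⟩, hfg⟩
    exact subset_sdiff.2 ⟨hκβ, (subset_sdiff.1 hκ₂β).2.symm⟩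
  choose next δ hnext hδ hδβ hδd hbad using step
  let b : ℕ → N := fun n => Nat.rec ⟨γ, hγ, hκγ, Subset.rfl⟩ (fun _ β => next β) n
  have hb : Antitone fun n => (b n).1 := antitone_nat_of_succ_le fun n => hnext (b n)
  have hlt : ∀ m n, m < n → Disjoint (δ (b m)) (δ (b n)) := fun m n hmn =>
    (hδd (b m)).mono_right ((hδβ (b n)).trans (hb (Nat.succ_le_of_lt hmn)))
  obtain ⟨m, hm⟩ := hs B hB V hV (fun n => δ (b n)) (fun n => hδ (b n)) fun m n hmn =>
    (lt_or_gt_of_ne hmn).elim (hlt m n) fun h => (hlt n m h).symm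
  obtain ⟨f, hf, g, hg, hgs, hfg⟩ := hbad (b (m + 1))
  exact hfg (hm (m + 1) (Nat.lt_succ_self m) f hf g hg hgs)

theorem RieszIntegral.biUnion_mem_SWB (hR : RieszSystem 𝒦 𝒢 ℬ ℱ 𝒯)
    (hℓ : RieszIntegral 𝒦 𝒢 ℬ ℱ 𝒯 ℓ) {B C : Set X} (hB : B ∈ ℬ) (hC : C ∈ ℬ) (hBC : B + B ⊆ C)
    {V : ℕ → Set (Z × Z)} (hV : IsCompSeq Z V) (A : ℕ → Set S) (N : ℕ)
    (hA : ∀ j < N, A j ∈ SWB 𝒦 𝒢 ℱ ℓ (V (j + 3)) C) :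
    (⋃ j ∈ Finset.range N, A j) ∈ SWB 𝒦 𝒢 ℱ ℓ (V 0) B := by
  classical
  obtain ⟨-, hs, hunif⟩ := hℓ
  have hω : (⋃ j ∈ Finset.range N, A j) ∈ 𝒢 :=
    hR.G_biUnion _ fun j hj => (hA j (Finset.mem_range.1 hj)).1
  refine ⟨hω, fun f hf g hg ⟨κ₁, hκ₁, hκ₁ω, hg₀⟩ => ?_⟩
  obtain ⟨γ₁, hγ₁, hκγ₁, hγ₁ω, hsmall⟩ :=
    hs.exists_diff_mem_SWB hR hC (hV.ent 2) hκ₁ hω hκ₁ω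
  obtain ⟨γ', hγ', κ', hκ', hκγ', hγκ', hκ'γ₁⟩ := hR.KG_interpose κ₁ hκ₁ γ₁ hγ₁ hκγ₁
  let J : ℕ → Finset (Set S) := fun k => (Finset.range k).image fun j => A j ∩ γ₁
  have hAγ : ∀ j < N, A j ∩ γ₁ ∈ 𝒢 := fun j hj => hR.G_inter _ (hA j hj).1 _ hγ₁
  have hmem : ∀ k, ∀ j < k, A j ∩ γ₁ ∈ J k := fun k j hj =>
    Finset.mem_image_of_mem _ (Finset.mem_range.2 hj)
  have hJG : ∀ γ ∈ J N, γ ∈ 𝒢 := by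
    intro γ hγ
    obtain ⟨j, hj, rfl⟩ := Finset.mem_image.1 hγ
    exact hAγ j (Finset.mem_range.1 hj)
  have hcover : κ' ⊆ ⋃ γ ∈ J N, γ := by
    intro s hs
    obtain ⟨j, hj, hsj⟩ := mem_iUnion₂.1 (hγ₁ω (hκ'γ₁ hs))
    exact mem_iUnion₂.2 ⟨_, hmem N j (Finset.mem_range.1 hj), hsj, hκ'γ₁ hs⟩
  obtain ⟨φ, hφ, hφJ, hφg⟩ := hR.F_partunity B hB (J N) hJG κ' hκ' hcover g hg
  have hJmono : ∀ k ≤ N, J k ⊆ J N := fun k hk =>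
    Finset.image_subset_image (Finset.range_mono hk)
  have hBC' : B ⊆ C := hR.subset_of_add_subset hB hBC
  have hchain : (ℓ f, ℓ (f + ∑ γ ∈ J N, φ γ)) ∈ V 2 := by
    have h := (hV.shift 2).chain (fun k => ℓ (f + ∑ γ ∈ J k, φ γ)) N 0 fun j _ hj => by
      have hj' : j < N := by omega
      have hJs : J (j + 1) = insert (A j ∩ γ₁) (J j) := by
        simp only [J, Finset.range_add_one, Finset.image_insert]
      by_cases hin : A j ∩ γ₁ ∈ J j
      · have : J (j + 1) = J j := by rw [hJs, Finset.insert_eq_of_mem hin]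
        simp only [this]
        exact hV.refl _ _
      · simp only [hJs, Finset.sum_insert hin, add_comm (φ (A j ∩ γ₁)), ← add_assoc]
        obtain ⟨hφB, hφs⟩ := hφ _ (hmem N j hj')
        exact (hA j hj').2 _ (hR.FB_add hBC hf (hφJ _ (hJmono j hj'.le))) _ (FB.mono hBC' hφB)
          (hφs.mono inter_subset_left)
    simpa [J] using h
  obtain ⟨D, hD, hCD⟩ := hR.B_add C hC C hC
  obtain ⟨T, hT, hTV⟩ := (hunif D hD).1 (V 2) (hV.ent 2).1
  obtain ⟨T', hT', hTT⟩ := hR.T_add T hT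
  obtain ⟨U, hU, hext⟩ := hR.F_ext B hB T' hT'
  have h_sum_supp : SupportedBy 𝒦 (∑ γ ∈ J N, φ γ) γ₁ := by
    refine (hR.supportedBy_sum (J N) fun γ hγ => (hφ γ hγ).2).mono (iUnion₂_subset fun γ hγ => ?_)
    obtain ⟨j, -, rfl⟩ := Finset.mem_image.1 hγ
    exact inter_subset_right
  have h_sum_B := hφJ _ Finset.Subset.rfl
  obtain ⟨p, hp, q, hq, hps, hqs, hpq⟩ := hext κ₁ hκ₁ γ₁ hγ₁ hκγ₁ g hg _ h_sum_B
    ⟨κ₁, hκ₁, hκγ₁, hg₀⟩ h_sum_supp ⟨γ', hγ', hκγ', hγκ'.trans hκ'γ₁, fun s hs => by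
      rw [hφg s (hγκ' hs), Finset.sum_apply]
      exact refl_mem_uniformity hU⟩
  have hfg := hR.FB_add hBC hf hg
  have hf_sum := hR.FB_add hBC hf h_sum_B
  have hpC := FB.mono hBC' hp
  have hqC := FB.mono hBC' hq
  have h₁ := hsmall.2 _ hfg p hpC hps
  have h₂ := hsmall.2 _ hf_sum q hqC hqs
  have h₃ := hTV _ (hR.FB_add hCD hfg hpC) _ (hR.FB_add hCD hf_sum hqC) (by
    rw [add_assoc, add_assoc]
    exact hTT _ _ _ _ (hR.T_refl _ hT' f hf.1) hpq)
  exact hV.comp 0 _ _ _ (hV.comp 1 _ _ _ hchain h₂)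
    (hV.comp 1 _ _ _ (hV.symm 2 h₃) (hV.symm 2 h₁))

theorem RieszIntegral.wSmall_of_mem_SWB (hZadd : UniformContinuous fun p : Z × Z => p.1 + p.2)
    (hR : RieszSystem 𝒦 𝒢 ℬ ℱ 𝒯) (hℓ : RieszIntegral 𝒦 𝒢 ℬ ℱ 𝒯 ℓ) {τ : Set S → X → Z}
    (hτ : IsTau 𝒦 𝒢 ℬ ℱ ℓ τ) {B : Set X} (hB : B ∈ ℬ) {V : ℕ → Set (Z × Z)} (hV : IsCompSeq Z V)
    {γ : Set S} (hγ : γ ∈ SWB 𝒦 𝒢 ℱ ℓ (V 3) B) {α : Set S} (hα : α ⊆ γ) :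
    WSmall 𝒦 𝒢 τ B (V 0) α := by
  refine ⟨γ, hγ.1, hα, fun K hK hd hKγ x y hx hy => ?_⟩
  obtain ⟨hadd, hs, hunif⟩ := hℓ
  rcases K.eq_empty_or_nonempty with rfl | hne
  · simpa using hV.refl 0 0
  obtain ⟨C, hC, hBC⟩ := hR.B_add B hB B hB
  obtain ⟨D, hD, hCD⟩ := hR.B_add C hC C hC
  have hκ₀ : (⋃ κ ∈ K, κ) ∈ 𝒦 := hR.K_biUnion K fun κ hκ => hK hκ
  obtain ⟨β, hβ, hκβ, hβγ, hsmall⟩ :=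
    hs.exists_diff_mem_SWB hR hC (hV.ent 3) hκ₀ hγ.1 (iUnion₂_subset hKγ)
  obtain ⟨b, hb, hbd⟩ := hR.exists_disjoint_nhds K hK hd hβ
    fun κ hκ => (subset_biUnion_of_mem (u := fun κ => κ) hκ).trans hκβ
  obtain ⟨E, hE, hEV⟩ := exists_entourage_sum hZadd K (hV.ent 3).1
  have hxy : ∀ κ ∈ K, x κ + y κ ∈ C := fun κ hκ => hBC (add_mem_add (hx κ hκ) (hy κ hκ))
  have hF : ∀ κ ∈ K, ∃ f ∈ FStar 𝒦 𝒢 ℱ (x κ) κ (b κ) B, (τ κ (x κ), ℓ f) ∈ E := fun κ hκ =>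
    hτ.exists_FStar_near hR hE (hK hκ) (hb κ hκ).1 (hb κ hκ).2.1 _ hB (hx κ hκ)
  have hG : ∀ κ ∈ K, ∃ f ∈ FStar 𝒦 𝒢 ℱ (y κ) κ (b κ) B, (τ κ (y κ), ℓ f) ∈ E := fun κ hκ =>
    hτ.exists_FStar_near hR hE (hK hκ) (hb κ hκ).1 (hb κ hκ).2.1 _ hB (hy κ hκ)
  have hH : ∀ κ ∈ K, ∃ f ∈ FStar 𝒦 𝒢 ℱ (x κ + y κ) κ (b κ) C, (τ κ (x κ + y κ), ℓ f) ∈ E :=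
    fun κ hκ => hτ.exists_FStar_near hR hE (hK hκ) (hb κ hκ).1 (hb κ hκ).2.1 _ hC (hxy κ hκ)
  choose! f hf hfE using hF
  choose! g hg _ using hG
  choose! h hh hhE using hH
  have hfs : ∀ κ ∈ K, SupportedBy 𝒦 (f κ) (b κ) := fun κ hκ => (hf κ hκ).2.2
  have hgs : ∀ κ ∈ K, SupportedBy 𝒦 (g κ) (b κ) := fun κ hκ => (hg κ hκ).2.2
  have hhs : ∀ κ ∈ K, SupportedBy 𝒦 (h κ) (b κ) := fun κ hκ => (hh κ hκ).2.2
  have hbG : ∀ κ ∈ K, b κ ∈ 𝒢 := fun κ hκ => (hb κ hκ).1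
  have hbβ : (⋃ κ ∈ K, b κ) ⊆ β := iUnion₂_subset fun κ hκ => (hb κ hκ).2.2
  have hfB := hR.FB_sum_of_disjoint_support hB hbd hfs fun κ hκ => (hf κ hκ).1
  have hgB := hR.FB_sum_of_disjoint_support hB hbd hgs fun κ hκ => (hg κ hκ).1
  have hhC := hR.FB_sum_of_disjoint_support hC hbd hhs fun κ hκ => (hh κ hκ).1
  have hfβ := (hR.supportedBy_sum K hfs).mono hbβ
  have hgβ := (hR.supportedBy_sum K hgs).mono hbβ
  have hhβ := (hR.supportedBy_sum K hhs).mono hbβ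
  have hfgC := hR.FB_add hBC hfB hgB
  have hω : ∀ κ ∈ K, ∃ ω ∈ 𝒢, κ ⊆ ω ∧ ω ⊆ b κ ∧ ∀ s ∈ ω, f κ s + g κ s = h κ s := by
    intro κ hκ
    obtain ⟨ω₁, hω₁, hκ₁, h₁⟩ := (hf κ hκ).2.1
    obtain ⟨ω₂, hω₂, hκ₂, h₂⟩ := (hg κ hκ).2.1
    obtain ⟨ω₃, hω₃, hκ₃, h₃⟩ := (hh κ hκ).2.1
    refine ⟨b κ ∩ (ω₁ ∩ (ω₂ ∩ ω₃)), hR.G_inter _ (hbG κ hκ) _ (hR.G_inter _ hω₁ _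
      (hR.G_inter _ hω₂ _ hω₃)), subset_inter (hb κ hκ).2.1 (subset_inter hκ₁
      (subset_inter hκ₂ hκ₃)), inter_subset_left, fun s hs => ?_⟩
    rw [h₁ s hs.2.1, h₂ s hs.2.2.1, h₃ s hs.2.2.2]
  choose! ω hωG hκω hωb hωeq using hω
  obtain ⟨T, hT, hTV⟩ := (hunif D hD).1 (V 3) (hV.ent 3).1
  obtain ⟨U, hU, hext⟩ := hR.F_ext C hC T hT
  obtain ⟨p, hp, q, hq, hps, hqs, hpq⟩ := hext _ hκ₀ β hβ hκβ _ hfgC _ hhC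
    (hR.supportedBy_add hfβ hgβ) hhβ ⟨⋃ κ ∈ K, ω κ, hR.G_biUnion K hωG, iUnion₂_mono hκω,
      (iUnion₂_mono hωb).trans hbβ, fun s hs => by
        obtain ⟨κ, hκ, hsκ⟩ := mem_iUnion₂.1 hs
        have hsb := hωb κ hκ hsκ
        rw [Pi.add_apply, sum_apply_of_disjoint_support hbd hfs hκ hsb,
          sum_apply_of_disjoint_support hbd hgs hκ hsb,
          sum_apply_of_disjoint_support hbd hhs hκ hsb, hωeq κ hκ s hsκ]
        exact refl_mem_uniformity hU⟩
  have e₁ : (∑ κ ∈ K, τ κ (x κ), ℓ (∑ κ ∈ K, f κ)) ∈ V 3 := by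
    rw [hadd.map_sum hR hne hbG hbd hfs fun κ hκ => (hf κ hκ).1.1]
    exact hEV _ _ hfE
  have e₂ := hγ.2 _ hfB _ hgB (hgβ.mono hβγ)
  have e₃ := hsmall.2 _ hfgC p hp hps
  have e₄ := hTV _ (hR.FB_add hCD hfgC hp) _ (hR.FB_add hCD hhC hq) hpq
  have e₅ := hV.symm 3 (hsmall.2 _ hhC q hq hqs)
  have e₆ : (ℓ (∑ κ ∈ K, h κ), ∑ κ ∈ K, τ κ (x κ + y κ)) ∈ V 3 := by
    rw [hadd.map_sum hR hne hbG hbd hhs fun κ hκ => (hh κ hκ).1.1]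
    exact hV.symm 3 (hEV _ _ hhE)
  exact hV.comp 0 _ _ _ (hV.comp 1 _ _ _ (hV.comp 2 _ _ _ e₁ e₂) (hV.comp 2 _ _ _ e₃ e₄))
    (hV.succ 1 (hV.comp 2 _ _ _ e₅ e₆))

end Integrals

end Systems

theorem stmt17 {S : Type u} {X : Type v} {Z : Type w}
    [AddCommMonoid X] [UniformSpace X] [T2Space X]
    [AddCommMonoid Z] [UniformSpace Z] [T2Space Z]
    (hZadd : UniformContinuous fun p : Z × Z => p.1 + p.2)
    {𝒦 𝒢 : Set (Set S)} {ℬ : Set (Set X)} {ℱ : Set (S → X)}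
    {𝒯 : Filter ((S → X) × (S → X))}
    (hRS : RieszSystem 𝒦 𝒢 ℬ ℱ 𝒯)
    (ℓ : (S → X) → Z) (hℓ : RieszIntegral 𝒦 𝒢 ℬ ℱ 𝒯 ℓ)
    (τ : Set S → X → Z) (hτ : IsTau 𝒦 𝒢 ℬ ℱ ℓ τ) :
    ∀ B ∈ ℬ, ∀ W : Set (Z × Z), IsUnifEnt Z W →
      ∀ α : ℕ → Set S, (∀ n, α n ∈ 𝒦) → (∀ m n : ℕ, m ≠ n → Disjoint (α m) (α n)) →
        ∃ m : ℕ, ∀ n > m, WSmall 𝒦 𝒢 τ B W (α n) := by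
  intro B hB W hW α hα hαd
  obtain ⟨V, hV, hVW⟩ := exists_isCompSeq hZadd hW.1
  obtain ⟨C, hC, hBC⟩ := hRS.B_add B hB B hB
  have hγ : ∀ n, ∃ β ∈ 𝒢, α n ⊆ β ∧ β ⊆ univ ∧ β \ α n ∈ SWB 𝒦 𝒢 ℱ ℓ (V (n + 7)) C := fun n =>
    hℓ.2.1.exists_diff_mem_SWB hRS hC (hV.ent (n + 7)) (hα n) hRS.univ_mem_G (subset_univ _)
  choose γ hγ hαγ _ hsmall using hγ
  choose γ' hγ' κ' hκ' hαγ' hγκ' hκγ' using fun n =>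
    hRS.KG_interpose (α n) (hα n) (γ n) (hγ n) (hαγ n)
  let δ : ℕ → Set S := fun n => γ' n \ ⋃ j ∈ Finset.range n, κ' j
  have hδ : ∀ n, δ n ∈ 𝒢 := fun n =>
    (hRS.KG_diff _ (hRS.K_biUnion (Finset.range n) fun j _ => hκ' j) _ (hγ' n)).2
  have hlt : ∀ m n, m < n → Disjoint (δ m) (δ n) := fun m n hmn =>
    disjoint_sdiff_right.mono_left (sdiff_subset.trans ((hγκ' m).trans
      (subset_biUnion_of_mem (u := fun j => κ' j) (Finset.mem_coe.2 (Finset.mem_range.2 hmn)))))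
  obtain ⟨m, hm⟩ := hℓ.2.1 C hC (V 6) (hV.ent 6) δ hδ fun m n hmn =>
    (lt_or_gt_of_ne hmn).elim (hlt m n) fun h => (hlt n m h).symm
  refine ⟨m, fun n hn => ?_⟩
  let A : ℕ → Set S := fun j => Nat.casesOn j (δ n) fun j => γ j \ α j
  have hA := hℓ.biUnion_mem_SWB hRS hB hC hBC (hV.shift 3) A (n + 1) fun j _ => by
    cases j with
    | zero => exact ⟨hδ n, hm n hn⟩
    | succ j => exact hsmall j
  have hsub : α n ⊆ ⋃ j ∈ Finset.range (n + 1), A j := by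
    intro s hs
    by_cases h : s ∈ ⋃ j ∈ Finset.range n, κ' j
    · obtain ⟨j, hj, hsj⟩ := mem_iUnion₂.1 h
      have hjn := Finset.mem_range.1 hj
      refine mem_iUnion₂.2 ⟨j + 1, Finset.mem_range.2 (by omega), hκγ' j hsj, fun hsα => ?_⟩
      exact (hαd j n hjn.ne).le_bot ⟨hsα, hs⟩
    · exact mem_iUnion₂.2 ⟨0, Finset.mem_range.2 (by omega), hαγ' n hs, h⟩
  obtain ⟨β, hβ, hαβ, h⟩ := hℓ.wSmall_of_mem_SWB hZadd hRS hτ hB hV (by simpa using hA) hsub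
  exact ⟨β, hβ, hαβ, fun K hK hd hKβ x y hx hy => hVW (h K hK hd hKβ x y hx hy)⟩
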